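/- arXiv:2310.20528 — 2 statements merged into one kernel-verified Lean document; each statement's English description precedes it below -/
import Mathlib

section
/- Let ε ∈ ℝ and let R¹, R² : ℝ³ → ℝ be smooth functions of (x,y,t) with R¹(p) ≠ R²(p) at every point p, satisfying: R¹_t = (2R¹+R²)·R¹_x + ε/(R¹−R²)·(R¹_xx + R²_xx); R²_t = (R¹+2R²)·R²_x + ε/(R²−R¹)·(R¹_xx + R²_xx); R¹_y = (3(R¹)² + 2R¹R² + (R²)²)·R¹_x + ε/(R¹−R²)·(2(R¹_x)² + 2R¹_xR²_x + 2(R²_x)² + (3R¹+R²)·R¹_xx + 2(R¹+R²)·R²_xx); R²_y = (3(R²)² + 2R¹R² + (R¹)²)·R²_x + ε/(R²−R¹)·(2(R¹_x)² + 2R¹_xR²_x + 2(R²_x)² + (3R²+R¹)·R²_xx + 2(R¹+R²)·R¹_xx). Then u = R¹ + R² and w = (R¹)² + R¹R² + (R²)² form a solution of the Mikhalev system. -/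
/-- Partial derivative with respect to the first variable `x`. -/
noncomputable def pdx (u : ℝ → ℝ → ℝ → ℝ) (x y t : ℝ) : ℝ := deriv (fun s => u s y t) x

/-- Partial derivative with respect to the second variable `y`. -/
noncomputable def pdy (u : ℝ → ℝ → ℝ → ℝ) (x y t : ℝ) : ℝ := deriv (fun s => u x s t) y

/-- Partial derivative with respect to the third variable `t`. -/
noncomputable def pdt (u : ℝ → ℝ → ℝ → ℝ) (x y t : ℝ) : ℝ := deriv (fun s => u x y s) t

/-- Smoothness of a function of three real variables. -/
def Smooth3 (u : ℝ → ℝ → ℝ → ℝ) : Prop :=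
  ContDiff ℝ (⊤ : ℕ∞) (fun p : ℝ × ℝ × ℝ => u p.1 p.2.1 p.2.2)

/-- The Mikhalev system: `u_t = w_x` and `u_y = w_t - u w_x + w u_x`. -/
def Mikhalev (u w : ℝ → ℝ → ℝ → ℝ) : Prop :=
  ∀ x y t : ℝ,
    pdt u x y t = pdx w x y t ∧
    pdy u x y t = pdt w x y t - u x y t * pdx w x y t + w x y t * pdx u x y t

theorem Smooth3.hasDerivAt_pdx {u : ℝ → ℝ → ℝ → ℝ} (hu : Smooth3 u) (x y t : ℝ) :
    HasDerivAt (fun s => u s y t) (pdx u x y t) x := by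
  have h : Differentiable ℝ (fun p : ℝ × ℝ × ℝ => u p.1 p.2.1 p.2.2) :=
    ContDiff.differentiable hu (by simp)
  have hc : DifferentiableAt ℝ (fun s : ℝ => (s, y, t)) x := by fun_prop
  exact ((h (x, y, t)).comp x hc).hasDerivAt

theorem Smooth3.hasDerivAt_pdy {u : ℝ → ℝ → ℝ → ℝ} (hu : Smooth3 u) (x y t : ℝ) :
    HasDerivAt (fun s => u x s t) (pdy u x y t) y := by
  have h : Differentiable ℝ (fun p : ℝ × ℝ × ℝ => u p.1 p.2.1 p.2.2) :=
    ContDiff.differentiable hu (by simp)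
  have hc : DifferentiableAt ℝ (fun s : ℝ => (x, s, t)) y := by fun_prop
  exact ((h (x, y, t)).comp y hc).hasDerivAt

theorem Smooth3.hasDerivAt_pdt {u : ℝ → ℝ → ℝ → ℝ} (hu : Smooth3 u) (x y t : ℝ) :
    HasDerivAt (fun s => u x y s) (pdt u x y t) t := by
  have h : Differentiable ℝ (fun p : ℝ × ℝ × ℝ => u p.1 p.2.1 p.2.2) :=
    ContDiff.differentiable hu (by simp)
  have hc : DifferentiableAt ℝ (fun s : ℝ => (x, y, s)) t := by fun_prop
  exact ((h (x, y, t)).comp t hc).hasDerivAt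

theorem HasDerivAt.sq_add_mul_add_sq {f g : ℝ → ℝ} {f' g' s : ℝ}
    (hf : HasDerivAt f f' s) (hg : HasDerivAt g g' s) :
    HasDerivAt (fun r => f r ^ 2 + f r * g r + g r ^ 2)
      ((2 * f s + g s) * f' + (f s + 2 * g s) * g') s := by
  refine (((hf.fun_pow 2).fun_add (hf.fun_mul hg)).fun_add (hg.fun_pow 2)).congr_deriv ?_
  push_cast
  ring

theorem stmt_13 (ε : ℝ) (R1 R2 : ℝ → ℝ → ℝ → ℝ)
    (hR1 : Smooth3 R1) (hR2 : Smooth3 R2)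
    (hne : ∀ x y t : ℝ, R1 x y t ≠ R2 x y t)
    (ht1 : ∀ x y t : ℝ, pdt R1 x y t =
      (2 * R1 x y t + R2 x y t) * pdx R1 x y t
        + ε / (R1 x y t - R2 x y t) * (pdx (pdx R1) x y t + pdx (pdx R2) x y t))
    (ht2 : ∀ x y t : ℝ, pdt R2 x y t =
      (R1 x y t + 2 * R2 x y t) * pdx R2 x y t
        + ε / (R2 x y t - R1 x y t) * (pdx (pdx R1) x y t + pdx (pdx R2) x y t))
    (hy1 : ∀ x y t : ℝ, pdy R1 x y t =
      (3 * (R1 x y t) ^ 2 + 2 * R1 x y t * R2 x y t + (R2 x y t) ^ 2) * pdx R1 x y t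
        + ε / (R1 x y t - R2 x y t) *
          (2 * (pdx R1 x y t) ^ 2 + 2 * pdx R1 x y t * pdx R2 x y t
            + 2 * (pdx R2 x y t) ^ 2
            + (3 * R1 x y t + R2 x y t) * pdx (pdx R1) x y t
            + 2 * (R1 x y t + R2 x y t) * pdx (pdx R2) x y t))
    (hy2 : ∀ x y t : ℝ, pdy R2 x y t =
      (3 * (R2 x y t) ^ 2 + 2 * R1 x y t * R2 x y t + (R1 x y t) ^ 2) * pdx R2 x y t
        + ε / (R2 x y t - R1 x y t) *
          (2 * (pdx R1 x y t) ^ 2 + 2 * pdx R1 x y t * pdx R2 x y t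
            + 2 * (pdx R2 x y t) ^ 2
            + (3 * R2 x y t + R1 x y t) * pdx (pdx R2) x y t
            + 2 * (R1 x y t + R2 x y t) * pdx (pdx R1) x y t)) :
    Mikhalev (fun x y t => R1 x y t + R2 x y t)
      (fun x y t => (R1 x y t) ^ 2 + R1 x y t * R2 x y t + (R2 x y t) ^ 2) := by
  intro x y t
  have hux : pdx (fun x y t => R1 x y t + R2 x y t) x y t = pdx R1 x y t + pdx R2 x y t :=
    ((hR1.hasDerivAt_pdx x y t).fun_add (hR2.hasDerivAt_pdx x y t)).deriv
  have huy : pdy (fun x y t => R1 x y t + R2 x y t) x y t = pdy R1 x y t + pdy R2 x y t :=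
    ((hR1.hasDerivAt_pdy x y t).fun_add (hR2.hasDerivAt_pdy x y t)).deriv
  have hut : pdt (fun x y t => R1 x y t + R2 x y t) x y t = pdt R1 x y t + pdt R2 x y t :=
    ((hR1.hasDerivAt_pdt x y t).fun_add (hR2.hasDerivAt_pdt x y t)).deriv
  have hwx : pdx (fun x y t => (R1 x y t) ^ 2 + R1 x y t * R2 x y t + (R2 x y t) ^ 2) x y t =
      (2 * R1 x y t + R2 x y t) * pdx R1 x y t + (R1 x y t + 2 * R2 x y t) * pdx R2 x y t :=
    ((hR1.hasDerivAt_pdx x y t).sq_add_mul_add_sq (hR2.hasDerivAt_pdx x y t)).deriv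
  have hwt : pdt (fun x y t => (R1 x y t) ^ 2 + R1 x y t * R2 x y t + (R2 x y t) ^ 2) x y t =
      (2 * R1 x y t + R2 x y t) * pdt R1 x y t + (R1 x y t + 2 * R2 x y t) * pdt R2 x y t :=
    ((hR1.hasDerivAt_pdt x y t).sq_add_mul_add_sq (hR2.hasDerivAt_pdt x y t)).deriv
  have hd : R1 x y t - R2 x y t ≠ 0 := sub_ne_zero.mpr (hne x y t)
  have hneg : ε / (R2 x y t - R1 x y t) = -(ε / (R1 x y t - R2 x y t)) := by
    rw [← neg_sub, div_neg]
  rw [hux, huy, hut, hwx, hwt, ht1, ht2, hy1, hy2, hneg]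
  constructor
  · ring
  · field_simp
    ring
end

section
/- Let ε ∈ ℝ and let q : ℝ³ → ℝ be a smooth function of (x,y,t) satisfying q_tt = 2q_t·q_xx + 4q_x·q_xt − 6q_x²·q_xx + 2ε²·q_xxxx and its symmetry q_y = 3q_x·q_t − 2q_x³ + 2ε²·q_xxx at every point. Then u = q_x and w = q_t form a solution of the Mikhalev system. -/
/-- Mixed directional derivatives of a smooth function commute. -/
theorem fderiv_fderiv_apply_comm {E : Type*} [NormedAddCommGroup E] [NormedSpace ℝ E]
    {f : E → ℝ} (hf : ContDiff ℝ (⊤ : ℕ∞) f) (p v w : E) :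
    fderiv ℝ (fun z => fderiv ℝ f z v) p w = fderiv ℝ (fun z => fderiv ℝ f z w) p v := by
  have hd : DifferentiableAt ℝ (fderiv ℝ f) p :=
    (hf.fderiv_right (m := 1) (by norm_cast)).differentiable (by norm_num) p
  have key (a b : E) :
      fderiv ℝ (fun z => fderiv ℝ f z a) p b = fderiv ℝ (fderiv ℝ f) p b a := by
    rw [fderiv_clm_apply hd (differentiableAt_const a)]
    simp
  rw [key, key]
  exact (hf.contDiffAt.isSymmSndFDerivAt (by simp; norm_cast)).eq w v

namespace Smooth3

variable {u : ℝ → ℝ → ℝ → ℝ}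

theorem hasDerivAt_line (hu : Smooth3 u) {γ : ℝ → ℝ × ℝ × ℝ} {v : ℝ × ℝ × ℝ} {s : ℝ}
    (hγ : HasDerivAt γ v s) :
    HasDerivAt (fun r => u (γ r).1 (γ r).2.1 (γ r).2.2)
      (fderiv ℝ (fun p : ℝ × ℝ × ℝ => u p.1 p.2.1 p.2.2) (γ s) v) s :=
  ((ContDiff.differentiable hu (by simp)) (γ s)).hasFDerivAt.comp_hasDerivAt s hγ

theorem hasDerivAt_x (hu : Smooth3 u) (x y t : ℝ) :
    HasDerivAt (fun s => u s y t)
      (fderiv ℝ (fun p : ℝ × ℝ × ℝ => u p.1 p.2.1 p.2.2) (x, y, t) (1, 0, 0)) x :=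
  hu.hasDerivAt_line (γ := fun s => (s, y, t))
    ((hasDerivAt_id x).prodMk (hasDerivAt_const x (y, t)))

theorem pdx_eq (hu : Smooth3 u) (x y t : ℝ) :
    pdx u x y t =
      fderiv ℝ (fun p : ℝ × ℝ × ℝ => u p.1 p.2.1 p.2.2) (x, y, t) (1, 0, 0) :=
  (hu.hasDerivAt_x x y t).deriv

theorem hasDerivAt_pdx_s16 (hu : Smooth3 u) (x y t : ℝ) :
    HasDerivAt (fun s => u s y t) (pdx u x y t) x := by
  rw [hu.pdx_eq]
  exact hu.hasDerivAt_x x y t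

theorem pdy_eq (hu : Smooth3 u) (x y t : ℝ) :
    pdy u x y t =
      fderiv ℝ (fun p : ℝ × ℝ × ℝ => u p.1 p.2.1 p.2.2) (x, y, t) (0, 1, 0) :=
  (hu.hasDerivAt_line (γ := fun s => (x, s, t)) ((hasDerivAt_const y x).prodMk
    ((hasDerivAt_id y).prodMk (hasDerivAt_const y t)))).deriv

theorem pdt_eq (hu : Smooth3 u) (x y t : ℝ) :
    pdt u x y t =
      fderiv ℝ (fun p : ℝ × ℝ × ℝ => u p.1 p.2.1 p.2.2) (x, y, t) (0, 0, 1) :=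
  (hu.hasDerivAt_line (γ := fun s => (x, y, s)) ((hasDerivAt_const t x).prodMk
    ((hasDerivAt_const t y).prodMk (hasDerivAt_id t)))).deriv

theorem contDiff_fderiv_apply (hu : Smooth3 u) (v : ℝ × ℝ × ℝ) :
    ContDiff ℝ (⊤ : ℕ∞)
      (fun p => fderiv ℝ (fun p : ℝ × ℝ × ℝ => u p.1 p.2.1 p.2.2) p v) :=
  (ContDiff.fderiv_right hu (by simp)).clm_apply contDiff_const

theorem smooth_pdx (hu : Smooth3 u) : Smooth3 (pdx u) := by
  simpa only [Smooth3, hu.pdx_eq] using hu.contDiff_fderiv_apply (1, 0, 0)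

theorem smooth_pdy (hu : Smooth3 u) : Smooth3 (pdy u) := by
  simpa only [Smooth3, hu.pdy_eq] using hu.contDiff_fderiv_apply (0, 1, 0)

theorem smooth_pdt (hu : Smooth3 u) : Smooth3 (pdt u) := by
  simpa only [Smooth3, hu.pdt_eq] using hu.contDiff_fderiv_apply (0, 0, 1)

theorem pdy_pdx_comm (hu : Smooth3 u) (x y t : ℝ) :
    pdy (pdx u) x y t = pdx (pdy u) x y t := by
  rw [hu.smooth_pdx.pdy_eq, hu.smooth_pdy.pdx_eq]
  simp only [hu.pdx_eq, hu.pdy_eq]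
  exact fderiv_fderiv_apply_comm hu _ _ _

theorem pdt_pdx_comm (hu : Smooth3 u) (x y t : ℝ) :
    pdt (pdx u) x y t = pdx (pdt u) x y t := by
  rw [hu.smooth_pdx.pdt_eq, hu.smooth_pdt.pdx_eq]
  simp only [hu.pdx_eq, hu.pdt_eq]
  exact fderiv_fderiv_apply_comm hu _ _ _

end Smooth3

theorem stmt_16 (ε : ℝ) (q : ℝ → ℝ → ℝ → ℝ) (hq : Smooth3 q)
    (heq : ∀ x y t : ℝ, pdt (pdt q) x y t =
      2 * pdt q x y t * pdx (pdx q) x y t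
        + 4 * pdx q x y t * pdt (pdx q) x y t
        - 6 * (pdx q x y t) ^ 2 * pdx (pdx q) x y t
        + 2 * ε ^ 2 * pdx (pdx (pdx (pdx q))) x y t)
    (hsym : ∀ x y t : ℝ, pdy q x y t =
      3 * pdx q x y t * pdt q x y t - 2 * (pdx q x y t) ^ 3
        + 2 * ε ^ 2 * pdx (pdx (pdx q)) x y t) :
    Mikhalev (pdx q) (pdt q) := by
  intro x y t
  refine ⟨hq.pdt_pdx_comm x y t, ?_⟩
  have hx := hq.smooth_pdx
  have hxy : pdx (pdy q) x y t =
      3 * pdx (pdx q) x y t * pdt q x y t + 3 * pdx q x y t * pdx (pdt q) x y t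
        - 6 * (pdx q x y t) ^ 2 * pdx (pdx q) x y t
        + 2 * ε ^ 2 * pdx (pdx (pdx (pdx q))) x y t := by
    have h1 := hx.hasDerivAt_pdx_s16 x y t
    have h2 := hq.smooth_pdt.hasDerivAt_pdx_s16 x y t
    have h3 := hx.smooth_pdx.smooth_pdx.hasDerivAt_pdx_s16 x y t
    have h := (((h1.const_mul 3).mul h2).sub ((h1.pow 3).const_mul 2)).add
      (h3.const_mul (2 * ε ^ 2))
    rw [pdx, funext fun s => hsym s y t]
    refine (h.congr_deriv ?_).deriv
    ring
  rw [hq.pdy_pdx_comm, hxy, heq, hq.pdt_pdx_comm]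
  ring
end
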